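/- arXiv:2111.03107 — 2 statements merged into one kernel-verified Lean document; each statement's English description precedes it below -/
import Mathlib

section
/- Let R be a commutative Noetherian ring of Krull dimension d, and let P be a finitely generated projective R-module of rank r > d. Then P ≅ P' ⊕ R for some projective R-module P'. -/
/-- Prime avoidance for an intersection: if no prime of `B` is contained in a prime of `A`, some
element lies in every prime of `B` and in no prime of `A`. -/
theorem Ideal.exists_mem_forall_notMem_of_not_le {R : Type*} [CommRing R] {A B : Finset (Ideal R)}
    (hA : ∀ q ∈ A, q.IsPrime) (h : ∀ p ∈ B, ∀ q ∈ A, ¬ p ≤ q) :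
    ∃ c : R, (∀ p ∈ B, c ∈ p) ∧ ∀ q ∈ A, c ∉ q := by
  have hnot : ¬ (((∏ p ∈ B, p : Ideal R) : Set R) ⊆ ⋃ q ∈ (A : Set (Ideal R)), (q : Set R)) := by
    intro hsub
    obtain ⟨q, hq, hle⟩ := (Ideal.subset_union_prime (f := fun q : Ideal R => q) ⊥ ⊥
      (fun q hq _ _ => hA q hq)).1 hsub
    obtain ⟨p, hp, hpq⟩ := ((hA q hq).prod_le).1 hle
    exact h p hp q hq hpq
  obtain ⟨c, hc, hcA⟩ := Set.not_subset.1 hnot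
  simp only [Set.mem_iUnion, not_exists, SetLike.mem_coe] at hcA
  refine ⟨c, fun p hp => ?_, hcA⟩
  exact (Finset.inf_le (f := fun p : Ideal R => p) hp) (Ideal.prod_le_inf hc)

/-- Prime avoidance for the coset `a + (s)` and an antichain of primes not containing `s`. -/
theorem Ideal.exists_add_mul_notMem_of_isAntichain {R : Type*} [CommRing R]
    {T : Finset (Ideal R)} (hT : ∀ q ∈ T, q.IsPrime) (hanti : ∀ p ∈ T, ∀ q ∈ T, p ≤ q → p = q)
    {s : R} (hs : ∀ q ∈ T, s ∉ q) (a : R) : ∃ c : R, ∀ q ∈ T, a + s * c ∉ q := by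
  classical
  obtain ⟨c, hcB, hcA⟩ := Ideal.exists_mem_forall_notMem_of_not_le
    (A := T.filter (a ∈ ·)) (B := T.filter (a ∉ ·))
    (fun q hq => hT q (Finset.mem_filter.1 hq).1) (by
      intro p hp q hq hpq
      obtain ⟨hp, hap⟩ := Finset.mem_filter.1 hp
      obtain ⟨hq, haq⟩ := Finset.mem_filter.1 hq
      exact hap (hanti p hp q hq hpq ▸ haq))
  refine ⟨c, fun q hq hmem => ?_⟩
  by_cases haq : a ∈ q
  · rcases (hT q hq).mem_or_mem ((q.add_mem_iff_right haq).1 hmem) with h | h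
    · exact hs q hq h
    · exact hcA q (Finset.mem_filter.2 ⟨hq, haq⟩) h
  · have hc := hcB q (Finset.mem_filter.2 ⟨hq, haq⟩)
    exact haq ((q.add_mem_iff_left (q.mul_mem_left s hc)).1 hmem)

/-- Let `V(I) \ V(s)` consist of primes of coheight less than `k`. Then any `k` elements can be
changed by multiples of `s` so that their common zeros in `V(I)` all lie in `V(s)`. -/
theorem Ideal.exists_add_mul_mem_imp_mem {R : Type*} [CommRing R] [IsNoetherianRing R] (s : R)
    (k : ℕ) (I : Ideal R)
    (hI : ∀ p : PrimeSpectrum R, I ≤ p.asIdeal → s ∉ p.asIdeal → Order.coheight p < k)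
    (a : Fin k → R) :
    ∃ c : Fin k → R, ∀ p : PrimeSpectrum R, I ≤ p.asIdeal →
      (∀ i, a i + s * c i ∈ p.asIdeal) → s ∈ p.asIdeal := by
  classical
  induction k generalizing I with
  | zero =>
    refine ⟨a, fun p hp _ => ?_⟩
    by_contra hs
    simpa using hI p hp hs
  | succ k ih =>
    obtain ⟨c₀, hc₀⟩ := Ideal.exists_add_mul_notMem_of_isAntichain
      (T := (Ideal.finite_minimalPrimes_of_isNoetherianRing R I).toFinset.filter (s ∉ ·))
      (fun q hq => by
        simp only [Finset.mem_filter, Set.Finite.mem_toFinset] at hq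
        exact hq.1.1.1)
      (fun p hp q hq hpq => by
        simp only [Finset.mem_filter, Set.Finite.mem_toFinset] at hp hq
        exact le_antisymm hpq (hq.1.2 hp.1.1 hpq))
      (fun q hq => (Finset.mem_filter.1 hq).2) (a 0)
    obtain ⟨c, hc⟩ := ih (I ⊔ Ideal.span {a 0 + s * c₀}) (fun p hp hsp => by
      have hIp := le_sup_left.trans hp
      obtain ⟨q, hq, hqp⟩ := Ideal.exists_minimalPrimes_le hIp
      have hsq : s ∉ q := fun h => hsp (hqp h)
      have huq : a 0 + s * c₀ ∉ q := hc₀ q (by simp [hq, hsq])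
      have hup : a 0 + s * c₀ ∈ p.asIdeal :=
        (le_sup_right.trans hp) (Ideal.mem_span_singleton_self _)
      have hlt : (⟨q, hq.1.1⟩ : PrimeSpectrum R) < p :=
        lt_of_le_of_ne hqp (fun h => huq (by rw [← h] at hup; exact hup))
      have h1 := Order.coheight_add_one_le hlt
      have h2 := h1.trans_lt (hI ⟨q, hq.1.1⟩ hq.1.2 hsq)
      push_cast at h2
      exact lt_of_add_lt_add_right h2) (fun i => a i.succ)
    refine ⟨Fin.cons c₀ c, fun p hp hmem => hc p (sup_le hp ?_) (fun i => ?_)⟩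
    · rw [Ideal.span_singleton_le_iff_mem]
      simpa using hmem 0
    · simpa using hmem i.succ

/-- At a prime where a finitely presented module is free of rank `r`, there are `r` elements and
`r` functionals whose pairing matrix has determinant outside the prime. -/
theorem Module.exists_det_notMem {R M : Type*} [CommRing R] [AddCommGroup M] [Module R M]
    [Module.FinitePresentation R M] (p : PrimeSpectrum R) {r : ℕ}
    [Module.Free (Localization.AtPrime p.asIdeal) (LocalizedModule p.asIdeal.primeCompl M)]
    (hrank : Module.rankAtStalk M p = r) :
    ∃ (b : Fin r → M) (f : Fin r → M →ₗ[R] R),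
      (Matrix.of fun i j => f i (b j)).det ∉ p.asIdeal := by
  let S := p.asIdeal.primeCompl
  let A := Localization.AtPrime p.asIdeal
  let β : Module.Basis (Fin r) A (LocalizedModule S M) := Module.finBasisOfFinrankEq A _ hrank
  let ι := LocalizedModule.mkLinearMap S M
  have hb (j : Fin r) : ∃ x : M × S, x.2 • β j = ι x.1 := IsLocalizedModule.surj S ι (β j)
  choose b hb using hb
  have hf (i : Fin r) : ∃ x : (M →ₗ[R] R) × S, x.2 • (β.coord i).restrictScalars R =
      IsLocalizedModule.map S ι (Algebra.linearMap R A) x.1 :=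
    IsLocalizedModule.surj S (IsLocalizedModule.map S ι (Algebra.linearMap R A)) _
  choose f hf using hf
  refine ⟨fun j => (b j).1, fun i => (f i).1, ?_⟩
  have key (i j : Fin r) : algebraMap R A ((f i).1 (b j).1) =
      (Matrix.diagonal fun i => algebraMap R A ((f i).2 * (b i).2)) i j := by
    have h1 := IsLocalizedModule.map_apply S ι (Algebra.linearMap R A) (f i).1 (b j).1
    rw [← hf i, ← hb j] at h1
    rw [Algebra.linearMap_apply] at h1
    rw [← h1]
    simp only [LinearMap.smul_apply, LinearMap.restrictScalars_apply, Submonoid.smul_def]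
    rw [← algebraMap_smul A ((b j).2 : R) (β j), map_smul, Module.Basis.coord_apply,
      Module.Basis.repr_self]
    by_cases hij : i = j
    · subst hij
      simp [Algebra.smul_def]
    · simp [Matrix.diagonal_apply_ne _ hij, Finsupp.single_eq_of_ne hij]
  have hunit : IsUnit (algebraMap R A (Matrix.of fun i j => (f i).1 (b j).1).det) := by
    rw [RingHom.map_det]
    have : (algebraMap R A).mapMatrix (Matrix.of fun i j => (f i).1 (b j).1) =
        Matrix.diagonal fun i => algebraMap R A ((f i).2 * (b i).2) := by
      ext i j
      exact key i j
    rw [this, Matrix.det_diagonal, ← map_prod]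
    exact (IsLocalization.AtPrime.isUnit_to_map_iff A p.asIdeal _).2
      (prod_mem fun i _ => mul_mem (f i).2.2 (b i).2.2)
  exact (IsLocalization.AtPrime.isUnit_to_map_iff A p.asIdeal _).1 hunit

/-- A module which is finitely presented and locally free of rank `r` becomes free of rank `r`
after inverting an element avoiding a given finite antichain of primes. -/
theorem Module.exists_dual_families_of_isAntichain {R M : Type*} [CommRing R] [AddCommGroup M]
    [Module R M] [Module.FinitePresentation R M] {r : ℕ}
    (hfree : ∀ p : PrimeSpectrum R,
      Module.Free (Localization.AtPrime p.asIdeal) (LocalizedModule p.asIdeal.primeCompl M))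
    (hrank : ∀ p : PrimeSpectrum R, Module.rankAtStalk M p = r)
    {T : Finset (Ideal R)} (hT : ∀ q ∈ T, q.IsPrime)
    (hanti : ∀ p ∈ T, ∀ q ∈ T, p ≤ q → p = q) :
    ∃ (s : R) (b : Fin r → M) (f : Fin r → M →ₗ[R] R), (∀ q ∈ T, s ∉ q) ∧
      ∀ i j, f i (b j) = if i = j then s else 0 := by
  classical
  have hloc (q : Ideal R) : ∃ (b : Fin r → M) (f : Fin r → M →ₗ[R] R),
      q ∈ T → (Matrix.of fun i j => f i (b j)).det ∉ q := by
    by_cases hq : q ∈ T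
    · have := hfree ⟨q, hT q hq⟩
      obtain ⟨b, f, h⟩ := Module.exists_det_notMem (M := M) ⟨q, hT q hq⟩ (hrank _)
      exact ⟨b, f, fun _ => h⟩
    · exact ⟨0, 0, fun h => absurd h hq⟩
  choose b f hdet using hloc
  have he (q : Ideal R) : ∃ e : R, q ∈ T → e ∉ q ∧ ∀ p ∈ T, p ≠ q → e ∈ p := by
    by_cases hq : q ∈ T
    · obtain ⟨e, heB, heA⟩ := Ideal.exists_mem_forall_notMem_of_not_le (A := {q}) (B := T.erase q)
        (by simpa using hT q hq) (by
          intro p hp q' hq' hle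
          rw [Finset.mem_singleton] at hq'
          subst hq'
          exact (Finset.mem_erase.1 hp).1 (hanti p (Finset.mem_erase.1 hp).2 q' hq hle))
      exact ⟨e, fun _ => ⟨heA q (Finset.mem_singleton_self q),
        fun p hp hpq => heB p (Finset.mem_erase.2 ⟨hpq, hp⟩)⟩⟩
    · exact ⟨0, fun h => absurd h hq⟩
  choose e he using he
  let B : Fin r → M := fun j => ∑ q ∈ T, e q • b q j
  let F : Fin r → M →ₗ[R] R := fun i => ∑ q ∈ T, e q • f q i
  let N : Matrix (Fin r) (Fin r) R := Matrix.of fun i j => F i (B j)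
  have hN : ∀ q ∈ T, N.det ∉ q := by
    intro q hq
    have := hT q hq
    rw [← Ideal.Quotient.eq_zero_iff_mem, RingHom.map_det]
    have hmap : (Ideal.Quotient.mk q).mapMatrix N = (Ideal.Quotient.mk q (e q * e q)) •
        (Ideal.Quotient.mk q).mapMatrix (Matrix.of fun i j => f q i (b q j)) := by
      have hz : ∀ p ∈ T, p ≠ q → Ideal.Quotient.mk q (e p) = 0 := fun p hp hpq =>
        Ideal.Quotient.eq_zero_iff_mem.2 ((he p hp).2 q hq hpq.symm)
      ext i j
      simp only [RingHom.mapMatrix_apply, Matrix.map_apply, Matrix.smul_apply, Matrix.of_apply,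
        N, F, B, LinearMap.sum_apply, map_sum, LinearMap.smul_apply, map_smul, smul_eq_mul,
        map_mul]
      rw [Finset.sum_eq_single_of_mem q hq (fun p hp hpq => by simp [hz p hp hpq]),
        Finset.sum_eq_single_of_mem q hq (fun p hp hpq => by simp [hz p hp hpq])]
      ring
    rw [hmap, Matrix.det_smul, ← RingHom.map_det, ← map_pow, ← map_mul,
      Ideal.Quotient.eq_zero_iff_mem]
    intro hmem
    rcases this.mem_or_mem hmem with h | h
    · rcases this.mem_or_mem (this.mem_of_pow_mem _ h) with h | h <;> exact (he q hq).1 h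
    · exact hdet q hq h
  refine ⟨N.det, B, fun i => ∑ k, N.adjugate i k • F k, hN, fun i j => ?_⟩
  have h := congrFun (congrFun N.adjugate_mul i) j
  rw [Matrix.mul_apply, Matrix.smul_apply, Matrix.one_apply] at h
  simpa [N, LinearMap.sum_apply] using h

/-- If the primes containing `I` have coheight less than `k ≤ r`, a finitely presented locally
free module of rank `r` has an element which is unimodular modulo `I`. -/
theorem Module.exists_range_eval_sup_eq_top {R M : Type*} [CommRing R] [IsNoetherianRing R]
    [AddCommGroup M] [Module R M] [Module.FinitePresentation R M] {r : ℕ}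
    (hfree : ∀ p : PrimeSpectrum R,
      Module.Free (Localization.AtPrime p.asIdeal) (LocalizedModule p.asIdeal.primeCompl M))
    (hrank : ∀ p : PrimeSpectrum R, Module.rankAtStalk M p = r) (k : ℕ) (hk : k ≤ r)
    (I : Ideal R) (hI : ∀ p : PrimeSpectrum R, I ≤ p.asIdeal → Order.coheight p < k) :
    ∃ x : M, LinearMap.range (Module.Dual.eval R M x) ⊔ I = ⊤ := by
  induction k generalizing I with
  | zero =>
    refine ⟨0, ?_⟩
    by_contra hne
    obtain ⟨m, hm, hle⟩ := Ideal.exists_le_maximal _ hne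
    simpa using hI ⟨m, hm.isPrime⟩ (le_sup_right.trans hle)
  | succ k ih =>
    have hfin := Ideal.finite_minimalPrimes_of_isNoetherianRing R I
    obtain ⟨s, b, f, hs, hbf⟩ := Module.exists_dual_families_of_isAntichain hfree hrank
      (T := hfin.toFinset) (fun q hq => (hfin.mem_toFinset.1 hq).1.1)
      (fun p hp q hq hpq =>
        le_antisymm hpq ((hfin.mem_toFinset.1 hq).2 (hfin.mem_toFinset.1 hp).1 hpq))
    obtain ⟨x, hx⟩ := ih (by lia) (I ⊔ Ideal.span {s}) (fun p hp => by
      obtain ⟨q, hq, hqp⟩ := Ideal.exists_minimalPrimes_le (le_sup_left.trans hp)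
      have hsp : s ∈ p.asIdeal := (le_sup_right.trans hp) (Ideal.mem_span_singleton_self s)
      have hlt : (⟨q, hq.1.1⟩ : PrimeSpectrum R) < p :=
        lt_of_le_of_ne hqp
          (fun h => hs q (hfin.mem_toFinset.2 hq) (by rw [← h] at hsp; exact hsp))
      have h2 := (Order.coheight_add_one_le hlt).trans_lt (hI ⟨q, hq.1.1⟩ hq.1.2)
      push_cast at h2
      exact lt_of_add_lt_add_right h2)
    obtain ⟨c, hc⟩ := Ideal.exists_add_mul_mem_imp_mem (s * s) r I
      (fun p hp _ => (hI p hp).trans_le (by exact_mod_cast hk)) (fun i => f i x)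
    set y : M := x + s • ∑ j, c j • b j with hy
    have hfy (i : Fin r) : f i y = f i x + s * s * c i := by
      simp only [hy, map_add, map_smul, map_sum, hbf, smul_eq_mul, mul_ite, mul_zero,
        Finset.sum_ite_eq, Finset.mem_univ, if_true]
      ring
    refine ⟨y, ?_⟩
    by_contra hne
    obtain ⟨m, hm, hle⟩ := Ideal.exists_le_maximal _ hne
    have hmem (g : Module.Dual R M) : g y ∈ m := hle (Ideal.mem_sup_left ⟨g, rfl⟩)
    have hIm : I ≤ m := le_sup_right.trans hle
    have hss : s * s ∈ m := hc ⟨m, hm.isPrime⟩ hIm (fun i => hfy i ▸ hmem (f i))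
    have hsm : s ∈ m := (hm.isPrime.mem_or_mem hss).elim id id
    refine hm.ne_top (top_le_iff.1 (hx ▸ sup_le ?_
      (sup_le hIm ((Ideal.span_singleton_le_iff_mem m).2 hsm))))
    rintro _ ⟨g, rfl⟩
    have hg := hmem g
    rw [hy, map_add, map_smul, smul_eq_mul] at hg
    exact (m.add_mem_iff_left (m.mul_mem_right _ hsm)).1 hg


/-- Serre's splitting theorem: let R be a commutative Noetherian ring of Krull
dimension d and P a finitely generated projective R-module of rank r > d (rank r meaning the
localization of P at every prime is free of rank r). Then P ≅ P' ⊕ R for some projective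
R-module P'. -/
theorem serre_splitting (R : Type*) [CommRing R] [IsNoetherianRing R] (d r : ℕ)
    (hdim : ringKrullDim R = d) (hr : d < r)
    (P : Type*) [AddCommGroup P] [Module R P] [Module.Finite R P] [Module.Projective R P]
    (hfree : ∀ p : PrimeSpectrum R,
      Module.Free (Localization.AtPrime p.asIdeal) (LocalizedModule p.asIdeal.primeCompl P))
    (hrank : ∀ p : PrimeSpectrum R, Module.rankAtStalk P p = r) :
    ∃ P' : Submodule R P, Module.Projective R P' ∧ Nonempty (P ≃ₗ[R] P' × R) := by
  have := Module.finitePresentation_of_projective R P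
  obtain ⟨x, hx⟩ := Module.exists_range_eval_sup_eq_top hfree hrank r le_rfl ⊥ (fun p _ => by
    have h : (Order.coheight p : WithBot ℕ∞) ≤ (d : ℕ∞) :=
      (Order.coheight_le_krullDim p).trans_eq hdim
    exact (WithBot.coe_le_coe.1 h).trans_lt (by exact_mod_cast hr))
  rw [sup_bot_eq] at hx
  obtain ⟨f, hf⟩ : (1 : R) ∈ LinearMap.range (Module.Dual.eval R P x) := hx ▸ Submodule.mem_top
  replace hf : f x = 1 := hf
  let π : P →ₗ[R] LinearMap.ker f := (LinearMap.id - f.smulRight x).codRestrict _ (fun y => by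
    simp [hf])
  have hπ (y : P) : (π y : P) = y - f y • x := rfl
  have hπ_ker (y : LinearMap.ker f) : π y = y := by
    ext
    rw [hπ, LinearMap.mem_ker.1 y.2, zero_smul, sub_zero]
  have hπx : π x = 0 := by
    ext
    simp [hπ, hf]
  refine ⟨LinearMap.ker f, Module.Projective.of_split (LinearMap.ker f).subtype π
    (LinearMap.ext hπ_ker), ⟨LinearEquiv.ofLinearMap (π.prod f)
      ((LinearMap.ker f).subtype.coprod (LinearMap.toSpanSingleton R P x)) ?_ ?_⟩⟩
  · ext y
    · simp [hπ_ker]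
    · simp
    · simp [hπx]
    · simp [hf]
  · ext y
    simp [hπ]
end

section
/- Every finitely generated projective module over the polynomial ring k[x_1,…,x_n] over a field k is free. -/
open Polynomial

/-- Two vectors of an `A`-module are in the same orbit under its `A`-linear automorphisms. -/
def SameLinearOrbit (A : Type*) {M : Type*} [CommRing A] [AddCommGroup M] [Module A M]
    (x y : M) : Prop :=
  ∃ e : M ≃ₗ[A] M, e x = y

namespace SameLinearOrbit

section Module

variable {A M N : Type*} [CommRing A] [AddCommGroup M] [Module A M] [AddCommGroup N] [Module A N]
  {x y z : M}

theorem refl (x : M) : SameLinearOrbit A x x := ⟨.refl A M, rfl⟩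

theorem symm : SameLinearOrbit A x y → SameLinearOrbit A y x := by
  rintro ⟨e, rfl⟩
  exact ⟨e.symm, e.symm_apply_apply x⟩

theorem trans : SameLinearOrbit A x y → SameLinearOrbit A y z → SameLinearOrbit A x z := by
  rintro ⟨e, rfl⟩ ⟨f, rfl⟩
  exact ⟨e.trans f, rfl⟩

theorem congr (f : M ≃ₗ[A] N) : SameLinearOrbit A x y → SameLinearOrbit A (f x) (f y) := by
  rintro ⟨e, rfl⟩
  exact ⟨f.symm.trans (e.trans f), by simp⟩

theorem smul_unit (u : Aˣ) (x : M) : SameLinearOrbit A x (u • x) :=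
  ⟨LinearEquiv.smulOfUnit u, rfl⟩

/-- The orbit relation on column vectors is preserved by change of rings. -/
theorem map {B : Type*} [CommRing B] (φ : A →+* B) {n : ℕ} {v w : Fin n → A}
    (h : SameLinearOrbit A v w) : SameLinearOrbit B (φ ∘ v) (φ ∘ w) := by
  obtain ⟨e, rfl⟩ := h
  have hmul (f g : (Fin n → A) →ₗ[A] (Fin n → A)) (hfg : f ∘ₗ g = .id) :
      (LinearMap.toMatrix' f).map φ * (LinearMap.toMatrix' g).map φ = 1 := by
    rw [← Matrix.map_mul, ← LinearMap.toMatrix'_comp, hfg, LinearMap.toMatrix'_id]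
    simp
  refine ⟨Matrix.toLin'OfInv (hmul e.symm e (by ext; simp)) (hmul e e.symm (by ext; simp)), ?_⟩
  have : (e : (Fin n → A) → _) v = Matrix.mulVec (LinearMap.toMatrix' (e : _ →ₗ[A] _)) v := by
    rw [LinearMap.toMatrix'_mulVec]; rfl
  ext i
  rw [Function.comp_apply, this, RingHom.map_mulVec]
  simp [Matrix.toLin'OfInv]

theorem add_smul_prod (p q : A) (x m : M) (a b : A) :
    SameLinearOrbit A (p, q, x) (p, q, x + (a * p + b * q) • m) := by
  refine ⟨⟨⟨⟨fun z ↦ (z.1, z.2.1, z.2.2 + (a * z.1 + b * z.2.1) • m), fun y z ↦ ?_⟩, fun c z ↦ ?_⟩,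
    fun z ↦ (z.1, z.2.1, z.2.2 - (a * z.1 + b * z.2.1) • m), fun z ↦ ?_, fun z ↦ ?_⟩, rfl⟩
  · simp only [Prod.mk_add_mk, Prod.fst_add, Prod.snd_add, Prod.mk.injEq, true_and]
    module
  · simp only [Prod.smul_mk, Prod.smul_fst, Prod.smul_snd, RingHom.id_apply, Prod.mk.injEq,
      true_and, smul_eq_mul]
    module
  · simp
  · simp

theorem add_linearMap_prod (f : M →ₗ[A] A) (p q : A) (x : M) :
    SameLinearOrbit A (p, q, x) (p, q + f x, x) := by
  refine ⟨⟨⟨⟨fun z ↦ (z.1, z.2.1 + f z.2.2, z.2.2), fun y z ↦ ?_⟩, fun c z ↦ ?_⟩,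
    fun z ↦ (z.1, z.2.1 - f z.2.2, z.2.2), fun z ↦ ?_, fun z ↦ ?_⟩, rfl⟩
  · simp
    ring
  · simp [mul_add]
  · simp
  · simp

/-- Two solutions of a Bézout identity for `c ≠ 0` which are congruent modulo `c` are related by a
matrix of determinant one. -/
theorem of_bezout [IsDomain A] {c p q u v p' q' u' v' : A} (hc : c ≠ 0)
    (h : u * p + v * q = c) (h' : u' * p' + v' * q' = c)
    (hp : c ∣ p' - p) (hq : c ∣ q' - q) (hu : c ∣ u' - u) (hv : c ∣ v' - v) :
    SameLinearOrbit A (p, q) (p', q') := by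
  obtain ⟨dp, hp⟩ := hp
  obtain ⟨dq, hq⟩ := hq
  obtain ⟨du, hu⟩ := hu
  obtain ⟨dv, hv⟩ := hv
  obtain rfl := eq_add_of_sub_eq hp
  obtain rfl := eq_add_of_sub_eq hq
  obtain rfl := eq_add_of_sub_eq hu
  obtain rfl := eq_add_of_sub_eq hv
  have key : dp * u + dv * q + dq * v + du * p + (dp * du + dq * dv) * c = 0 := by
    apply mul_left_cancel₀ hc
    linear_combination h' - h
  have hdet : (1 + dp * u + dv * q) * (1 + dq * v + du * p) -
      (dp * v - dv * p) * (dq * u - du * q) = 1 := by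
    linear_combination key + (dp * du + dq * dv) * h
  refine ⟨⟨⟨⟨fun z ↦ ((1 + dp * u + dv * q) * z.1 + (dp * v - dv * p) * z.2,
      (dq * u - du * q) * z.1 + (1 + dq * v + du * p) * z.2), fun y z ↦ ?_⟩, fun a z ↦ ?_⟩,
    fun z ↦ ((1 + dq * v + du * p) * z.1 - (dp * v - dv * p) * z.2,
      -(dq * u - du * q) * z.1 + (1 + dp * u + dv * q) * z.2), fun z ↦ ?_, fun z ↦ ?_⟩, ?_⟩
  · ext <;> simp <;> ring
  · ext <;> simp <;> ring
  · ext
    · simp only; linear_combination z.1 * hdet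
    · simp only; linear_combination z.2 * hdet
  · ext
    · simp only; linear_combination z.1 * hdet
    · simp only; linear_combination z.2 * hdet
  · ext
    · change (1 + dp * u + dv * q) * p + (dp * v - dv * p) * q = _
      linear_combination dp * h
    · change (dq * u - du * q) * p + (1 + dq * v + du * p) * q = _
      linear_combination dq * h

theorem prodMap_left (h : SameLinearOrbit A x y) (y' : N) :
    SameLinearOrbit A (x, y') (y, y') := by
  obtain ⟨e, rfl⟩ := h
  exact ⟨e.prodCongr (.refl A N), rfl⟩

end Module

end SameLinearOrbit

section StableRange

variable {A : Type*} [CommRing A] [IsDomain A] [IsPrincipalIdealRing A]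

theorem exists_isCoprime_add_mul {p q d a b c : A} (hp : p ≠ 0) (h : a * p + b * q + c * d = 1) :
    ∃ t, IsCoprime p (q + t * d) := by
  classical
  let t := ((UniqueFactorizationMonoid.factors p).filter (¬ · ∣ q)).prod
  refine ⟨t, isCoprime_of_irreducible_dvd (fun h0 ↦ hp h0.1) fun π hπ hπp hπq ↦ ?_⟩
  by_cases hq : π ∣ q
  · have htd : π ∣ t * d := (dvd_add_right hq).1 hπq
    rcases hπ.prime.dvd_or_dvd htd with ht | hd
    · obtain ⟨g, hg, hπg⟩ := hπ.prime.exists_mem_multiset_dvd ht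
      rw [Multiset.mem_filter] at hg
      exact hg.2 ((hπ.dvd_symm (UniqueFactorizationMonoid.irreducible_of_factor g hg.1) hπg).trans
        hq)
    · exact hπ.not_isUnit (isUnit_of_dvd_one (h ▸
        dvd_add (dvd_add (hπp.mul_left a) (hq.mul_left b)) (hd.mul_left c)))
  · obtain ⟨g, hg, hπg⟩ := UniqueFactorizationMonoid.exists_mem_factors_of_dvd hp hπ hπp
    have : π ∣ t := hπg.dvd.trans
      (Multiset.dvd_prod (Multiset.mem_filter.2 ⟨hg, fun hgq ↦ hq (hπg.dvd.trans hgq)⟩))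
    exact hq ((dvd_add_left (this.mul_right d)).1 hπq)

/-- Stable range condition for a principal ideal domain modulo a nonzero element. -/
theorem exists_isCoprime_add_sum_mul {ι : Type*} [Fintype ι] {p q a b : A} {r w : ι → A}
    (hp : p ≠ 0) (h : a * p + b * q + ∑ i, w i * r i = 1) :
    ∃ t : ι → A, IsCoprime p (q + ∑ i, t i * r i) := by
  obtain ⟨d, hd⟩ := IsPrincipalIdealRing.principal (Ideal.span (Set.range r))
  obtain ⟨s, hs⟩ : ∃ s : ι → A, ∑ i, s i * r i = d :=
    Ideal.mem_span_range_iff_exists_fun.1 (hd.ge (Ideal.mem_span_singleton_self d))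
  have hr (i : ι) : d ∣ r i :=
    Ideal.mem_span_singleton.1 (hd.le (Ideal.subset_span (Set.mem_range_self i)))
  obtain ⟨c, hc⟩ : d ∣ ∑ i, w i * r i := Finset.dvd_sum fun i _ ↦ (hr i).mul_left _
  obtain ⟨t, ht⟩ := exists_isCoprime_add_mul (a := a) (b := b) (q := q) (d := d) (c := c) hp
    (by rw [← h, hc, mul_comm c d])
  refine ⟨fun i ↦ t * s i, ?_⟩
  simpa only [mul_assoc, ← Finset.mul_sum, hs] using ht

end StableRange

section Suslin

variable {R : Type*} [CommRing R]

/-- If `p` is monic and `p`, `q` generate the unit ideal modulo an ideal `I` of the coefficients,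
then the ideal `(p, q)` contains a constant congruent to `1` modulo `I`. -/
theorem exists_bezout_eq_C_of_isCoprime_map (I : Ideal R) {p q : R[X]} (hp : p.Monic)
    (h : IsCoprime (p.map (Ideal.Quotient.mk I)) (q.map (Ideal.Quotient.mk I))) :
    ∃ c : R, c - 1 ∈ I ∧ ∃ u v : R[X], u * p + v * q = C c := by
  obtain ⟨a', b', hab⟩ := h
  obtain ⟨a, rfl⟩ := map_surjective _ Ideal.Quotient.mk_surjective a'
  obtain ⟨b, rfl⟩ := map_surjective _ Ideal.Quotient.mk_surjective b'
  let J : Ideal R[X] := Ideal.span {p, q}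
  have hmem : 1 - (a * p + b * q) ∈ I.map C := by
    rw [← Ideal.mk_ker (I := I), ← ker_mapRingHom, RingHom.mem_ker]
    simp [hab]
  have hfin : Module.Finite R (R[X] ⧸ J) := by
    have := hp.finite_quotient
    exact Module.Finite.of_surjective
      (Ideal.Quotient.factorₐ R (Ideal.span_mono (s := {p}) (t := {p, q}) (by simp))).toLinearMap
      (Ideal.Quotient.factor_surjective (Ideal.span_mono (by simp)))
  have htop : I.map (algebraMap R (R[X] ⧸ J)) = ⊤ := by
    rw [Ideal.eq_top_iff_one, show algebraMap R (R[X] ⧸ J) = (Ideal.Quotient.mk J).comp C from rfl,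
      ← Ideal.map_map]
    convert Ideal.mem_map_of_mem (Ideal.Quotient.mk J) hmem
    have : a * p + b * q ∈ J := Ideal.mem_span_pair.2 ⟨a, b, rfl⟩
    rw [map_sub, Ideal.Quotient.eq_zero_iff_mem.2 this, map_one, sub_zero]
  obtain ⟨c, hc, hc0⟩ := Submodule.exists_sub_one_mem_and_smul_eq_zero_of_fg_of_le_smul I
    (⊤ : Submodule R (R[X] ⧸ J)) hfin.fg_top (by
      rw [Ideal.smul_top_eq_map, htop]
      exact le_rfl)
  refine ⟨c, hc, Ideal.mem_span_pair.1 (Ideal.Quotient.eq_zero_iff_mem.1 ?_)⟩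
  have : algebraMap R (R[X] ⧸ J) c = 0 := by
    rw [Algebra.algebraMap_eq_smul_one]
    exact hc0 1 trivial
  exact this

/-- Vectors with polynomial entries: if a constant `c` lies in the ideal generated by two of
the entries, values at points congruent modulo `c` lie in the same orbit. -/
theorem SameLinearOrbit.comp_of_bezout [IsDomain R] {ι : Type*} [Finite ι] {p q u v : R[X]}
    (r : ι → R[X]) {c : R} (h : u * p + v * q = C c) (a b : R[X]) (hab : C c ∣ b - a) :
    SameLinearOrbit R[X] (p.comp a, q.comp a, fun i ↦ (r i).comp a)
      (p.comp b, q.comp b, fun i ↦ (r i).comp b) := by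
  by_cases hc : c = 0
  · obtain rfl : b = a := by simpa [hc, sub_eq_zero] using hab
    exact .refl _
  have hdvd (f : R[X]) : C c ∣ f.comp b - f.comp a := hab.trans <| by
    simpa only [eval_map, comp] using sub_dvd_eval_sub b a (f.map C)
  have hbez (x : R[X]) : u.comp x * p.comp x + v.comp x * q.comp x = C c := by
    simpa using congr($(h).comp x)
  choose m hm using fun i ↦ hdvd (r i)
  have h₁ : SameLinearOrbit R[X] (p.comp a, q.comp a) (p.comp b, q.comp b) :=
    .of_bezout (C_ne_zero.2 hc) (hbez a) (hbez b) (hdvd p) (hdvd q) (hdvd u) (hdvd v)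
  have h₂ := (h₁.prodMap_left (fun i ↦ (r i).comp a)).congr (LinearEquiv.prodAssoc R[X] _ _ _)
  have h₃ := SameLinearOrbit.add_smul_prod (p.comp b) (q.comp b) (fun i ↦ (r i).comp a) m
    (u.comp b) (v.comp b)
  have hr : (fun i ↦ (r i).comp a) + C c • m = fun i ↦ (r i).comp b := by
    ext1 i
    rw [Pi.add_apply, Pi.smul_apply, smul_eq_mul, ← hm, add_sub_cancel]
  rw [hbez b, hr] at h₃
  exact h₂.trans h₃

/-- Suslin's local-global argument: a unimodular vector of polynomials with a monic entry is in the
orbit of its constant terms. -/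
theorem SameLinearOrbit.eval_zero_of_monic [IsDomain R] {ι : Type*} [Fintype ι] {p q a b : R[X]}
    {r w : ι → R[X]} (hp : p.Monic) (h : a * p + b * q + ∑ i, w i * r i = 1) :
    SameLinearOrbit R[X] (p, q, r) (C (p.eval 0), C (q.eval 0), fun i ↦ C ((r i).eval 0)) := by
  let vec (x : R[X]) : R[X] × R[X] × (ι → R[X]) := (p.comp x, q.comp x, fun i ↦ (r i).comp x)
  let J : Ideal R :=
  { carrier := {c | ∀ x y : R[X], C c ∣ y - x → SameLinearOrbit R[X] (vec x) (vec y)}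
    zero_mem' := fun x y hxy ↦ by
      obtain rfl : y = x := by simpa [sub_eq_zero] using hxy
      exact .refl _
    add_mem' := fun {c d} hc hd x y ⟨z, hz⟩ ↦
      (hc x (x + C c * z) (by simp)).trans (hd _ _ ⟨z, by rw [C_add] at hz; linear_combination hz⟩)
    smul_mem' := fun c d hd x y hxy ↦ hd x y (dvd_trans (by simp) hxy) }
  have hJ : J = ⊤ := by
    by_contra hJ
    obtain ⟨m, hm, hJm⟩ := Ideal.exists_le_maximal J hJ
    let := Ideal.Quotient.field m
    let φ := mapRingHom (Ideal.Quotient.mk m)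
    obtain ⟨t', ht'⟩ := exists_isCoprime_add_sum_mul (p := φ p) (q := φ q) (a := φ a) (b := φ b)
      (r := φ ∘ r) (w := φ ∘ w) (hp.map _).ne_zero (by simpa using congr(φ $h))
    choose t ht using fun i ↦ map_surjective _ (Ideal.Quotient.mk_surjective (I := m)) (t' i)
    obtain ⟨c, hcm, u, v, huv⟩ := exists_bezout_eq_C_of_isCoprime_map m
      (q := q + ∑ i, t i * r i) hp (by simpa [φ, ht, Polynomial.map_sum] using ht')
    have key (x : R[X]) : SameLinearOrbit R[X] (vec x)
        (p.comp x, (q + ∑ i, t i * r i).comp x, fun i ↦ (r i).comp x) := by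
      convert SameLinearOrbit.add_linearMap_prod (Fintype.linearCombination R[X]
        (fun i ↦ (t i).comp x)) (p.comp x) (q.comp x) (fun i ↦ (r i).comp x) using 3
      simp [Fintype.linearCombination_apply, mul_comm]
    have hcJ : c ∈ J := fun x y hxy ↦
      ((key x).trans (.comp_of_bezout r huv x y hxy)).trans (key y).symm
    exact hm.ne_top ((Ideal.eq_top_iff_one m).2 (by simpa using m.sub_mem (hJm hcJ) hcm))
  have h1 : (1 : R) ∈ J := hJ ▸ trivial
  simpa [vec, comp_zero] using h1 X 0 (by simp)

end Suslin

/-- Every unimodular column over `A` can be completed to an invertible matrix. -/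
def UnimodularTransitive (A : Type*) [CommRing A] : Prop :=
  ∀ (n : ℕ) (v w : Fin (n + 1) → A), w ⬝ᵥ v = 1 → SameLinearOrbit A v (Pi.single 0 1)

section Unimodular

variable {A : Type*} [CommRing A]

theorem SameLinearOrbit.comp_perm {ι : Type*} (v : ι → A) (σ : Equiv.Perm ι) :
    SameLinearOrbit A v (v ∘ σ) :=
  ⟨LinearEquiv.funCongrLeft A A σ, rfl⟩

theorem SameLinearOrbit.single_of_isUnit {n : ℕ} {v : Fin (n + 1) → A} {i : Fin (n + 1)}
    (hv : IsUnit (v i)) : SameLinearOrbit A v (Pi.single 0 1) := by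
  obtain ⟨u, hu⟩ := hv
  refine (SameLinearOrbit.comp_perm v (.swap 0 i)).trans
    ((SameLinearOrbit.smul_unit u⁻¹ _).trans ?_)
  have hy0 : (u⁻¹ • (v ∘ Equiv.swap 0 i)) 0 = 1 := by simp [← hu, Units.smul_def]
  generalize u⁻¹ • (v ∘ Equiv.swap 0 i) = y at hy0
  refine ⟨⟨⟨⟨fun z ↦ z - z 0 • (y - Pi.single 0 1), fun a b ↦ ?_⟩, fun c a ↦ ?_⟩,
    fun z ↦ z + z 0 • (y - Pi.single 0 1), fun z ↦ ?_, fun z ↦ ?_⟩, ?_⟩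
  · simp only [Pi.add_apply]
    module
  · simp only [Pi.smul_apply, RingHom.id_apply, smul_eq_mul]
    module
  · simp [hy0]
  · simp [hy0]
  · simp [hy0]

theorem UnimodularTransitive.of_isField (hA : IsField A) : UnimodularTransitive A := by
  intro n v w h
  obtain ⟨i, hi⟩ : ∃ i, v i ≠ 0 := by
    by_contra! h0
    have : Nontrivial A := hA.nontrivial
    simp [dotProduct, h0] at h
  obtain ⟨b, hb⟩ := hA.mul_inv_cancel hi
  exact .single_of_isUnit (i := i) (.of_mul_eq_one b hb)

theorem SameLinearOrbit.comp_eval_zero {R : Type*} [CommRing R] [IsDomain R] {n : ℕ}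
    {v w : Fin (n + 2) → R[X]} (hv : (v 0).Monic) (h : w ⬝ᵥ v = 1) :
    SameLinearOrbit R[X] v (C ∘ fun i ↦ (v i).eval 0) := by
  rw [dotProduct, Fin.sum_univ_succ, Fin.sum_univ_succ, ← add_assoc] at h
  let e : (R[X] × R[X] × (Fin n → R[X])) ≃ₗ[R[X]] (Fin (n + 2) → R[X]) :=
    (LinearEquiv.refl R[X] R[X]).prodCongr (Fin.consLinearEquiv R[X] fun _ ↦ R[X]) |>.trans
      (Fin.consLinearEquiv R[X] fun _ ↦ R[X])
  have he (y : Fin (n + 2) → R[X]) : e (y 0, y (Fin.succ 0), fun i ↦ y i.succ.succ) = y := by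
    ext1 i
    refine Fin.cases rfl (fun i ↦ Fin.cases rfl (fun i ↦ rfl) i) i
  have := (SameLinearOrbit.eval_zero_of_monic hv h).congr e
  rw [he v] at this
  exact he (C ∘ fun i ↦ (v i).eval 0) ▸ this

/-- Transitivity on unimodular columns passes from `R` to a polynomial ring `A` over `R` in which
every nonzero element becomes monic, up to a unit, in suitable coordinates. -/
theorem UnimodularTransitive.of_polynomial {R : Type*} [CommRing R] [IsDomain R] [Nontrivial A]
    (hR : UnimodularTransitive R)
    (hA : ∀ f : A, f ≠ 0 → ∃ ψ : A ≃+* R[X], IsUnit (ψ f).leadingCoeff) :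
    UnimodularTransitive A := by
  intro n v w h
  obtain ⟨i, hi⟩ : ∃ i, v i ≠ 0 := by
    by_contra! h0
    simp [dotProduct, h0] at h
  cases n with
  | zero =>
    refine .single_of_isUnit (i := 0) (.of_mul_eq_one (w 0) ?_)
    simpa [dotProduct, mul_comm] using h
  | succ n =>
    obtain ⟨ψ, u, hu⟩ := hA _ hi
    let σ := Equiv.swap 0 i
    let s : R[X]ˣ := Units.map C.toMonoidHom u
    let y : Fin (n + 2) → R[X] := s⁻¹ • (ψ ∘ v ∘ σ)
    have hy0 : (y 0).Monic := by
      have : y 0 = C (↑u⁻¹ : R) * ψ (v i) := by simp [y, σ, s, Units.smul_def]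
      rw [this, Monic, leadingCoeff_mul, leadingCoeff_C, ← hu, Units.inv_mul]
    have hy : (s • (ψ ∘ w ∘ σ)) ⬝ᵥ y = 1 := by
      have : (w ∘ σ) ⬝ᵥ (v ∘ σ) = 1 := by rw [comp_equiv_dotProduct_comp_equiv, h]
      simp only [y, smul_dotProduct, dotProduct_smul]
      simpa [dotProduct] using congr(ψ $this)
    have h₁ : SameLinearOrbit R (fun i ↦ (y i).eval 0) (Pi.single 0 1) :=
      hR _ _ (fun j ↦ ((s • (ψ ∘ w ∘ σ)) j).eval 0)
        (by simpa only [dotProduct, eval_finsetSum, eval_mul, eval_one] using congr(eval 0 $hy))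
    have h₂ := (SameLinearOrbit.smul_unit s⁻¹ (ψ ∘ v ∘ σ)).trans
      ((SameLinearOrbit.comp_eval_zero hy0 hy).trans (h₁.map C))
    have h₃ := h₂.map (ψ.symm : R[X] →+* A)
    refine (SameLinearOrbit.comp_perm v σ).trans ?_
    convert h₃
    · ext; simp
    · ext j
      simp [Pi.single_apply, apply_ite]

theorem Module.Free.of_prod_linearEquiv_pi (hA : UnimodularTransitive A) {M : Type*}
    [AddCommGroup M] [Module A M] {n : ℕ} (e : (M × A) ≃ₗ[A] (Fin n → A)) : Module.Free A M := by
  cases n with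
  | zero =>
    have := e.toEquiv.subsingleton
    have : Subsingleton M := (Prod.mk_left_injective (0 : A)).subsingleton
    exact .of_subsingleton A M
  | succ n =>
    obtain ⟨g, hg⟩ := hA n (e (0, 1)) (fun i ↦ (e.symm (Pi.single i 1)).2) (by
      let f : (Fin (n + 1) → A) →ₗ[A] A := LinearMap.snd A M A ∘ₗ e.symm
      have hf : f (e (0, 1)) = 1 := by simp [f]
      refine Eq.trans ?_ hf
      rw [LinearMap.pi_apply_eq_sum_univ f, dotProduct]
      refine Finset.sum_congr rfl fun i _ ↦ ?_
      rw [smul_eq_mul, mul_comm]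
      have : (fun j ↦ if i = j then 1 else 0) = (Pi.single i 1 : Fin (n + 1) → A) := by
        ext j
        simp [Pi.single_apply, eq_comm]
      rw [this]
      rfl)
    let d : (M × A) ≃ₗ[A] (A × (Fin n → A)) :=
      (e.trans g).trans (Fin.consLinearEquiv A fun _ ↦ A).symm
    have hd : d (0, 1) = (1, 0) := by
      change (Fin.consLinearEquiv A fun _ ↦ A).symm (g (e (0, 1))) = _
      rw [hg, LinearEquiv.symm_apply_eq]
      ext i
      refine Fin.cases ?_ (fun i ↦ ?_) i <;> simp
    have hd' (a : A) : d (0, a) = (a, 0) := by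
      simpa using (d.map_smul a (0, 1)).trans (congr(a • $hd))
    have hs (a : A) : d.symm (a, 0) = (0, a) := by rw [← hd', d.symm_apply_apply]
    refine .of_equiv (M := Fin n → A) (LinearEquiv.ofLinearMap
      (LinearMap.fst A M A ∘ₗ d.symm ∘ₗ LinearMap.inr A A _)
      (LinearMap.snd A A _ ∘ₗ d ∘ₗ LinearMap.inl A M A) ?_ ?_)
    · ext1 x
      have : (0, (d (x, 0)).2) = d (x, 0) - ((d (x, 0)).1, 0) := by ext <;> simp
      simp [this, hs]
    · refine LinearMap.ext fun x ↦ ?_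
      have : ((d.symm (0, x)).1, 0) = d.symm (0, x) - (0, (d.symm (0, x)).2) := by ext <;> simp
      simp [this, hd']

theorem UnimodularTransitive.free_of_isStablyFree [Nontrivial A] (hA : UnimodularTransitive A)
    (M : Type*) [AddCommGroup M] [Module A M] [Module.Finite A M] [Module.IsStablyFree A M] :
    Module.Free A M := by
  obtain ⟨N, _, _, _, _, _⟩ := Module.IsStablyFree.exist_free_prod A M
  have key (m : ℕ) : Module.Free A (M × (Fin m → A)) → Module.Free A M := by
    induction m with
    | zero => exact fun _ ↦ .of_equiv (LinearEquiv.prodUnique : (M × (Fin 0 → A)) ≃ₗ[A] M)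
    | succ m ih =>
      let e : ((M × (Fin m → A)) × A) ≃ₗ[A] (M × (Fin (m + 1) → A)) :=
        (LinearEquiv.prodAssoc A M _ A).trans ((LinearEquiv.refl A M).prodCongr
          ((LinearEquiv.prodComm A _ A).trans (Fin.consLinearEquiv A fun _ ↦ A)))
      exact fun _ ↦ ih (.of_prod_linearEquiv_pi hA (e.trans
        (Module.finBasis A (M × (Fin (m + 1) → A))).equivFun))
  exact key _ (.of_equiv ((LinearEquiv.refl A M).prodCongr (Module.finBasis A N).equivFun))

end Unimodular

section StablyFree

variable {R M : Type*} [CommRing R] [AddCommGroup M]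

/-- Division by a monic polynomial is a linear retraction of the multiplication by it. -/
theorem Polynomial.Monic.exists_linearMap_mul_eq {g : R[X]} (hg : g.Monic) :
    ∃ ρ : R[X] →ₗ[R] R[X], ∀ p, ρ (g * p) = p := by
  have hdiv (p : R[X]) : g * (p /ₘ g) = p - modByMonicHom g p :=
    eq_sub_of_add_eq' (modByMonic_add_div p g)
  refine ⟨⟨⟨(· /ₘ g), fun p q ↦ hg.isRegular.left ?_⟩, fun a p ↦ hg.isRegular.left ?_⟩,
    fun p ↦ mul_divByMonic_cancel_left p hg⟩
  · simp only [mul_add, hdiv, map_add]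
    ring
  · simp only [RingHom.id_apply, mul_smul_comm, hdiv, map_smul, smul_sub]

variable [Module R[X] M]

theorem Module.Finite.of_monic_smul_eq_zero [Module R M] [IsScalarTower R R[X] M]
    [Module.Finite R[X] M] {g : R[X]} (hg : g.Monic) (h : ∀ x : M, g • x = 0) :
    Module.Finite R M := by
  have htors : Module.IsTorsionBySet R[X] M (Ideal.span {g} : Ideal R[X]) := by
    exact (Module.isTorsionBySet_span_singleton_iff g).2 h
  let _ := htors.module
  have := htors.isScalarTower (S := R)
  have := htors.isScalarTower (S := R[X])
  have := hg.finite_quotient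
  have : Module.Finite (R[X] ⧸ Ideal.span {g}) M := .of_restrictScalars_finite R[X] _ _
  exact .trans (R[X] ⧸ Ideal.span {g}) M

open Matrix in
/-- The kernel of the canonical presentation of an `R[X]`-module which is free over `R` is the image
of an injective characteristic matrix. -/
theorem exists_presentation_of_basis [IsDomain R] [Module R M] [IsScalarTower R R[X] M]
    {ι : Type*} [Fintype ι] [DecidableEq ι] (b : Module.Basis ι R M) :
    ∃ θ : (ι → R[X]) →ₗ[R[X]] (ι → R[X]), Function.Injective θ ∧
      Function.Exact θ (Fintype.linearCombination R[X] b) := by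
  let B : Matrix ι ι R := .of fun i j ↦ b.repr ((X : R[X]) • b j) i
  have hB (j : ι) : ∑ i, B i j • b i = (X : R[X]) • b j := b.sum_repr _
  let π := Fintype.linearCombination R[X] b
  let θ := (charmatrix B).mulVecLin
  have hθ' (z : ι → R[X]) (i : ι) : θ z i = X * z i - ∑ j, C (B i j) * z j := by
    simp [θ, charmatrix_apply, mulVec, dotProduct, sub_mul, Finset.sum_sub_distrib,
      Matrix.diagonal_apply]
  have hθ (j : ι) : θ (Pi.single j 1) = Pi.single j X - fun i ↦ C (B i j) := by
    ext1 i
    by_cases h : i = j <;> simp [hθ', Pi.single_apply, h]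
  have hθπ : π ∘ₗ θ = 0 := by
    refine LinearMap.pi_ext' fun j ↦ LinearMap.ext_ring ?_
    have : ∀ i, C (B i j) • b i = B i j • b i := fun i ↦ algebraMap_smul R[X] (B i j) (b i)
    simp only [LinearMap.comp_apply, LinearMap.single_apply, hθ, map_sub, π,
      Fintype.linearCombination_apply_single]
    simp [Fintype.linearCombination_apply, this, hB]
  have hdecomp (y : ι → R[X]) : ∃ z, ∃ c : ι → R, y = θ z + fun i ↦ C (c i) := by
    have hadd {y y' : ι → R[X]} (h : ∃ z, ∃ c : ι → R, y = θ z + fun i ↦ C (c i))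
        (h' : ∃ z, ∃ c : ι → R, y' = θ z + fun i ↦ C (c i)) :
        ∃ z, ∃ c : ι → R, y + y' = θ z + fun i ↦ C (c i) := by
      obtain ⟨z, c, rfl⟩ := h
      obtain ⟨z', c', rfl⟩ := h'
      refine ⟨z + z', c + c', ?_⟩
      ext1 i
      simp only [map_add, Pi.add_apply]
      ring
    have hX {y : ι → R[X]} (h : ∃ z, ∃ c : ι → R, y = θ z + fun i ↦ C (c i)) :
        ∃ z, ∃ c : ι → R, (X : R[X]) • y = θ z + fun i ↦ C (c i) := by
      obtain ⟨z, c, rfl⟩ := h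
      refine ⟨(X : R[X]) • z + fun i ↦ C (c i), B *ᵥ c, ?_⟩
      ext1 i
      simp only [Pi.smul_apply, Pi.add_apply, smul_eq_mul, map_add, map_smul]
      simp [hθ' (fun i ↦ C (c i)), mulVec, dotProduct]
      ring
    rw [← Finset.univ_sum_single y]
    refine Finset.sum_induction _ (fun y ↦ ∃ z, ∃ c : ι → R, y = θ z + fun i ↦ C (c i))
      (fun _ _ ↦ hadd) ⟨0, 0, by ext1; simp⟩ fun j _ ↦ ?_
    induction y j using Polynomial.induction_on with
    | C a => exact ⟨0, Pi.single j a, by ext1 i; by_cases h : i = j <;> simp [Pi.single_apply, h]⟩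
    | add p q hp hq => simpa only [Pi.single_add] using hadd hp hq
    | monomial n a h =>
      rw [pow_succ', mul_left_comm, ← smul_eq_mul X, Pi.single_smul]
      exact hX h
  refine ⟨θ, ?_, fun y ↦ ⟨fun hy ↦ ?_, ?_⟩⟩
  · refine (injective_iff_map_eq_zero θ).2 fun y hy ↦ ?_
    exact eq_zero_of_mulVec_eq_zero (charpoly_monic B).ne_zero hy
  · obtain ⟨z, c, rfl⟩ := hdecomp y
    have hc : ∑ i, c i • b i = 0 := by
      have hz : π (θ z) = 0 := congr($hθπ z)
      have : ∀ i, C (c i) • b i = c i • b i := fun i ↦ algebraMap_smul R[X] (c i) (b i)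
      rw [map_add] at hy
      simpa [Fintype.linearCombination_apply, this, π, hz] using hy
    have := Fintype.linearIndependent_iff.1 b.linearIndependent c hc
    exact ⟨z, by ext1 i; simp [this]⟩
  · rintro ⟨z, rfl⟩
    exact congr($hθπ z)

end StablyFree

theorem LinearMap.exists_comp_eq_of_injective {A L M N : Type*} [Ring A] [AddCommGroup L]
    [AddCommGroup M] [AddCommGroup N] [Module A L] [Module A M] [Module A N] {f : L →ₗ[A] M}
    (hf : Function.Injective f) (g : N →ₗ[A] M) (hg : ∀ x, g x ∈ f.range) :
    ∃ h : N →ₗ[A] L, ∀ x, f (h x) = g x := by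
  refine ⟨(LinearEquiv.ofInjective f hf).symm ∘ₗ g.codRestrict f.range hg, fun x ↦ ?_⟩
  exact congr(($((LinearEquiv.ofInjective f hf).apply_symm_apply ⟨g x, hg x⟩) : M))

/-- A finite projective `R[X]`-module containing a free submodule with cokernel killed by a monic
polynomial is stably free, provided projective modules over `R` are free. -/
theorem Module.IsStablyFree.of_monic_smul_mem.{u, v} {R : Type u} {M : Type v} [CommRing R]
    [IsDomain R] [AddCommGroup M] [Module R[X] M] [Module.Finite R[X] M] [Module.Projective R[X] M]
    (hR : ∀ (N : Type v) [AddCommGroup N] [Module R N] [Module.Finite R N] [Module.Projective R N],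
      Module.Free R N)
    {r : ℕ} (f : (Fin r → R[X]) →ₗ[R[X]] M) (hf : Function.Injective f) {g : R[X]} (hg : g.Monic)
    (hgf : ∀ x : M, g • x ∈ f.range) : Module.IsStablyFree R[X] M := by
  let _ : Module R M := Module.compHom M (C : R →+* R[X])
  have : IsScalarTower R R[X] M := .of_algebraMap_smul fun _ _ ↦ rfl
  have : Module.Projective R M := by
    obtain ⟨n, p, i, -, -, h⟩ := Module.Finite.exists_comp_eq_id_of_projective R[X] M
    exact .of_split (i.restrictScalars R) (p.restrictScalars R) (LinearMap.ext fun x ↦ congr($h x))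
  obtain ⟨ρ, hρ⟩ := hg.exists_linearMap_mul_eq
  obtain ⟨τ, hτ⟩ := LinearMap.exists_comp_eq_of_injective hf (LinearMap.lsmul R[X] M g) hgf
  replace hτ (z : Fin r → R[X]) : τ (f z) = g • z := hf (by simp [hτ])
  let q := f.range.mkQ
  have hqf := LinearMap.exact_map_mkQ_range f
  have hq : Function.Surjective q := f.range.mkQ_surjective
  obtain ⟨s, hs⟩ : ∃ s : (M ⧸ f.range) →ₗ[R] M, q.restrictScalars R ∘ₗ s = .id := by
    have := (Function.Exact.split_tfae (f := f.restrictScalars R) (g := q.restrictScalars R)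
      hqf hf hq).out 0 1
    refine this.2 ⟨ρ.compLeft (Fin r) ∘ₗ τ.restrictScalars R, LinearMap.ext fun z ↦ ?_⟩
    ext1 i
    simp [hτ, hρ]
  have : Module.Projective R (M ⧸ f.range) := .of_split s (q.restrictScalars R) hs
  have : Module.Finite R (M ⧸ f.range) := by
    refine .of_monic_smul_eq_zero hg fun x ↦ ?_
    obtain ⟨x, rfl⟩ := f.range.mkQ_surjective x
    rw [← map_smul]
    exact (Submodule.Quotient.mk_eq_zero _).2 (hgf x)
  have := hR (M ⧸ f.range)
  let b := Module.Free.chooseBasis R (M ⧸ f.range)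
  obtain ⟨θ, hθ, hθπ⟩ := exists_presentation_of_basis b
  let π := Fintype.linearCombination R[X] b
  obtain ⟨l, hl⟩ := Module.projective_lifting_property q π hq
  have hql y : q (l y) = π y := congr($hl y)
  obtain ⟨t, ht⟩ := LinearMap.exists_comp_eq_of_injective hf (l ∘ₗ θ) fun z ↦
    (hqf _).1 ((hql _).trans ((hθπ _).2 ⟨z, rfl⟩))
  have hexact : Function.Exact (θ.prod (-t)) (l.coprod f) := by
    rintro ⟨y, z⟩
    constructor
    · intro h
      replace h : l y + f z = 0 := h
      obtain ⟨w, rfl⟩ := (hθπ y).1 <| by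
        rw [← hql, eq_neg_of_add_eq_zero_left h, map_neg, hqf.apply_apply_eq_zero, neg_zero]
      refine ⟨w, Prod.ext rfl (hf ?_)⟩
      simpa [ht] using (eq_neg_of_add_eq_zero_right h).symm
    · rintro ⟨w, h⟩
      simp [← h, ht]
  have hsurj : Function.Surjective (l.coprod f) := by
    intro x
    obtain ⟨y, hy⟩ : ∃ y, π y = q x :=
      ⟨fun i ↦ C (b.repr (q x) i), by
        have (i : _) : C (b.repr (q x) i) • b i = b.repr (q x) i • b i :=
          algebraMap_smul R[X] (b.repr (q x) i) (b i)
        simp [π, Fintype.linearCombination_apply, this, b.sum_repr]⟩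
    obtain ⟨z, hz⟩ := (hqf (x - l y)).1 (by rw [map_sub, hql, hy, sub_self])
    exact ⟨(y, z), by simp [hz]⟩
  have hinj : Function.Injective (θ.prod (-t)) := fun x y h ↦ hθ congr(Prod.fst $h)
  obtain ⟨s, hs⟩ := Module.projective_lifting_property (l.coprod f) .id hsurj
  have := Module.Free.of_equiv
    ((hexact.splitSurjectiveEquiv hinj ⟨s, hs⟩).1.trans (.prodComm ..))
  exact .of_free_prod R[X] M (Module.Free.ChooseBasisIndex R (M ⧸ f.range) → R[X])

/-- The change of variables fixing `x₀` and sending `xᵢ` to `xᵢ + x₀ ^ N ^ i`, as an isomorphism of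
`k[x₀, …, xₙ]` with `k[x₁, …, xₙ][x₀]`. -/
theorem exists_mvPolynomial_equiv_polynomial (k : Type*) [Field k] (n N : ℕ) :
    ∃ ψ : MvPolynomial (Fin (n + 1)) k ≃ₐ[k] (MvPolynomial (Fin n) k)[X],
      ψ (.X 0) = X ∧ ∀ i : Fin n, ψ (.X i.succ) = X ^ N ^ (i + 1 : ℕ) + C (.X i) := by
  let T (c : k) : MvPolynomial (Fin (n + 1)) k →ₐ[k] MvPolynomial (Fin (n + 1)) k :=
    MvPolynomial.aeval (Fin.cons (.X 0) fun i ↦ .X i.succ + c • .X 0 ^ N ^ (i + 1 : ℕ))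
  have hT (c : k) : (T c).comp (T (-c)) = .id k _ := by
    refine MvPolynomial.algHom_ext fun i ↦ ?_
    cases i using Fin.cases <;> simp [T]
  refine ⟨(AlgEquiv.ofAlgHom (T 1) (T (-1)) (hT 1) (by simpa using hT (-1))).trans
    (MvPolynomial.finSuccEquiv k n), ?_, fun i ↦ ?_⟩
  · simp [T, MvPolynomial.finSuccEquiv_X_zero]
  · simp [T, MvPolynomial.finSuccEquiv_X_zero, MvPolynomial.finSuccEquiv_X_succ, add_comm]

theorem Fin.sum_pow_mul_injOn {m N : ℕ} (hN : 1 < N) :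
    Set.InjOn (fun v : Fin m → ℕ ↦ ∑ i : Fin m, v i * N ^ (i : ℕ))
      {v : Fin m → ℕ | ∀ i, v i < N} := by
  intro v hv w hw h
  refine List.ofFn_inj.mp (Nat.ofDigits_inj_of_len_eq hN (by simp) ?_ ?_ ?_)
  · simpa [List.mem_ofFn] using hv
  · simpa [List.mem_ofFn] using hw
  · simpa only [Nat.ofDigits_eq_sum_mapIdx, List.mapIdx_eq_ofFn, List.get_ofFn, List.length_ofFn,
      Fin.val_cast, List.sum_ofFn] using! h

/-- A nonzero polynomial over a field has a unit as leading coefficient with respect to one of the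
variables, after a suitable change of variables. -/
theorem MvPolynomial.exists_isUnit_leadingCoeff {k : Type*} [Field k] {n : ℕ}
    {f : MvPolynomial (Fin (n + 1)) k} (hf : f ≠ 0) :
    ∃ ψ : MvPolynomial (Fin (n + 1)) k ≃ₐ[k] (MvPolynomial (Fin n) k)[X],
      IsUnit (ψ f).leadingCoeff := by
  let N := 2 + f.totalDegree
  obtain ⟨ψ, hψ0, hψ⟩ := exists_mvPolynomial_equiv_polynomial k n N
  let d (v : Fin (n + 1) →₀ ℕ) : ℕ := ∑ i : Fin (n + 1), v i * N ^ (i : ℕ)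
  have hd : Set.InjOn d f.support := by
    have hlt {v} (hv : v ∈ f.support) (i) : v i < N :=
      ((monomial_le_degreeOf i hv).trans (degreeOf_le_totalDegree f i)).trans_lt (by lia)
    intro v hv w hw h
    exact DFunLike.coe_injective (Fin.sum_pow_mul_injOn (by lia) (hlt hv) (hlt hw) h)
  have hmonic (i) : (ψ (X i)).Monic ∧ (ψ (X i)).natDegree = N ^ (i : ℕ) := by
    cases i using Fin.cases with
    | zero => simp [hψ0, monic_X]
    | succ i => simp [hψ, monic_X_pow_add_C, N]
  have hmon (v : Fin (n + 1) →₀ ℕ) (a : k) (ha : a ≠ 0) :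
      (ψ (monomial v a)).leadingCoeff = C a ∧ (ψ (monomial v a)).natDegree = d v := by
    have hv : (∏ i, ψ (X i) ^ v i).Monic := monic_prod_of_monic _ _ fun i _ ↦ (hmonic i).1.pow _
    have ha' : ψ (C a) = Polynomial.C (C a) := ψ.commutes a
    rw [monomial_eq, Finsupp.prod_fintype _ _ (fun _ ↦ pow_zero _)]
    simp only [map_mul, map_prod, map_pow, ha']
    constructor
    · rw [leadingCoeff_mul, leadingCoeff_C, hv.leadingCoeff, mul_one]
    · rw [natDegree_C_mul (by simpa using ha),
        natDegree_prod_of_monic _ _ fun i _ ↦ (hmonic i).1.pow _]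
      simp [(hmonic _).1.natDegree_pow, (hmonic _).2, d]
  obtain ⟨v, hv, hmax⟩ := Finset.exists_max_image f.support d (support_nonempty.mpr hf)
  have hav : f.coeff v ≠ 0 := mem_support_iff.mp hv
  refine ⟨ψ, ?_⟩
  have hsum : ψ f = ψ (monomial v (f.coeff v)) +
      ∑ w ∈ f.support.erase v, ψ (monomial w (f.coeff w)) := by
    rw [Finset.add_sum_erase _ (fun w ↦ ψ (monomial w (f.coeff w))) hv, ← map_sum,
      f.support_sum_monomial_coeff]
  rw [hsum, add_comm, leadingCoeff_add_of_degree_lt, (hmon v _ hav).1]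
  · exact hav.isUnit.map C
  · refine (degree_sum_le _ _).trans_lt ((Finset.sup_lt_iff ?_).2 fun w hw ↦ ?_)
    · rw [bot_lt_iff_ne_bot, Ne, degree_eq_bot, map_eq_zero_iff _ ψ.injective]
      simpa using hav
    · have hwf := Finset.mem_of_mem_erase hw
      refine degree_lt_degree ?_
      rw [(hmon v _ hav).2, (hmon w _ (mem_support_iff.mp hwf)).2]
      exact (hmax w hwf).lt_of_ne fun h ↦ Finset.ne_of_mem_erase hw (hd hwf hv h)

/-- A finite module over a domain contains a free submodule with torsion cokernel. -/
theorem Module.Finite.exists_injective_smul_mem_range (A M : Type*) [CommRing A] [IsDomain A]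
    [AddCommGroup M] [Module A M] [Module.Finite A M] :
    ∃ (r : ℕ) (f : (Fin r → A) →ₗ[A] M), Function.Injective f ∧
      ∃ g : A, g ≠ 0 ∧ ∀ x, g • x ∈ f.range := by
  classical
  obtain ⟨n, v, hv⟩ := Module.Finite.exists_fin (R := A) (M := M)
  obtain ⟨s, hs, hmax⟩ := exists_maximal_linearIndepOn A v
  have (i : Fin n) : ∃ a : A, a ≠ 0 ∧ a • v i ∈ Submodule.span A (v '' s) := by
    by_cases hi : i ∈ s
    · exact ⟨1, one_ne_zero, by simpa using Submodule.subset_span (Set.mem_image_of_mem v hi)⟩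
    · exact hmax i hi
  choose a ha hav using this
  let e := Fintype.equivFin s
  let w (j : Fin (Fintype.card s)) : M := v (e.symm j)
  have hw : LinearIndependent A w := hs.comp e.symm e.symm.injective
  have hrange : (Fintype.linearCombination A w).range = Submodule.span A (v '' s) := by
    rw [Fintype.range_linearCombination, Set.image_eq_range, ← e.symm.surjective.range_comp]
    rfl
  refine ⟨_, Fintype.linearCombination A w, hw.fintypeLinearCombination_injective,
    ∏ i, a i, Finset.prod_ne_zero_iff.2 fun i _ ↦ ha i, fun x ↦ ?_⟩
  rw [hrange]
  have hx : x ∈ Submodule.span A (Set.range v) := hv ▸ Submodule.mem_top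
  induction hx using Submodule.span_induction with
  | mem x hx =>
    obtain ⟨i, rfl⟩ := hx
    rw [← Finset.prod_erase_mul _ _ (Finset.mem_univ i), mul_smul]
    exact Submodule.smul_mem _ _ (hav i)
  | zero => simp
  | add x y _ _ hx hy => simpa only [smul_add] using add_mem hx hy
  | smul c x _ hx => simpa only [smul_comm _ c x] using Submodule.smul_mem _ c hx

/-- Freeness of finite projective modules passes from `R` to `A` if every nonzero element of `A`
has a unit as leading coefficient under some isomorphism of `A` with `R[X]`. -/
theorem Module.Free.of_ringEquiv_polynomial.{u, w, v} {R : Type u} {A : Type w} {M : Type v}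
    [CommRing R] [IsDomain R] [CommRing A] [IsDomain A] [AddCommGroup M] [Module A M]
    [Module.Finite A M] [Module.Projective A M] (hR : UnimodularTransitive R)
    (hfree : ∀ (N : Type v) [AddCommGroup N] [Module R N] [Module.Finite R N]
      [Module.Projective R N], Module.Free R N)
    (hA : ∀ f : A, f ≠ 0 → ∃ ψ : A ≃+* R[X], IsUnit (ψ f).leadingCoeff) : Module.Free A M := by
  obtain ⟨r, f, hf, g, hg, hgf⟩ := Module.Finite.exists_injective_smul_mem_range A M
  obtain ⟨ψ, hψ⟩ := hA g hg
  let _ : Module R[X] M := Module.compHom M (ψ.symm : R[X] →+* A)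
  have hsmul (p : R[X]) (x : M) : p • x = ψ.symm p • x := rfl
  have := RingHomInvPair.of_ringEquiv ψ
  have := (RingHomInvPair.of_ringEquiv ψ).symm
  let e : M ≃ₛₗ[(ψ : A →+* R[X])] M :=
    { AddEquiv.refl M with
      map_smul' a x := show a • x = ψ.symm (ψ a) • x by rw [ψ.symm_apply_apply] }
  have : Module.Finite R[X] M := .of_surjective e.toLinearMap e.surjective
  have : Module.Projective R[X] M := .of_equiv e
  let f' : (Fin r → R[X]) →ₗ[R[X]] M :=
    { toFun z := f fun i ↦ ψ.symm (z i)
      map_add' z z' := by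
        rw [← f.map_add]
        exact congrArg f (funext fun i ↦ ψ.symm.map_add ..)
      map_smul' p z := by
        rw [RingHom.id_apply, hsmul, ← f.map_smul]
        exact congrArg f (funext fun i ↦ ψ.symm.map_mul ..) }
  have hf' : Function.Injective f' := fun z z' h ↦ by
    ext1 i
    exact ψ.symm.injective (congr_fun (hf h) i)
  obtain ⟨u, hu⟩ := hψ
  have hmonic : (C (↑u⁻¹ : R) * ψ g).Monic :=
    monic_C_mul_of_mul_leadingCoeff_eq_one (by rw [← hu, u.inv_mul])
  have : Module.IsStablyFree R[X] M := by
    refine .of_monic_smul_mem hfree f' hf' hmonic fun x ↦ ?_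
    obtain ⟨z, hz⟩ := hgf x
    rw [mul_smul]
    refine Submodule.smul_mem _ _ ⟨fun i ↦ ψ (z i), ?_⟩
    change f (fun i ↦ ψ.symm (ψ (z i))) = ψ.symm (ψ g) • x
    simpa only [ψ.symm_apply_apply] using hz
  have : UnimodularTransitive R[X] := hR.of_polynomial fun p hp ↦ by
    obtain ⟨χ, hχ⟩ := hA (ψ.symm p) (by simpa using hp)
    exact ⟨ψ.symm.trans χ, hχ⟩
  have := this.free_of_isStablyFree M
  exact .of_equiv e.symm

theorem UnimodularTransitive.mvPolynomial (k : Type*) [Field k] (n : ℕ) :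
    UnimodularTransitive (MvPolynomial (Fin n) k) := by
  induction n with
  | zero =>
    exact .of_isField ((MvPolynomial.isEmptyAlgEquiv k (Fin 0)).toMulEquiv.isField
      (Field.toIsField k))
  | succ n ih =>
    refine ih.of_polynomial fun f hf ↦ ?_
    obtain ⟨ψ, hψ⟩ := MvPolynomial.exists_isUnit_leadingCoeff hf
    exact ⟨ψ.toRingEquiv, hψ⟩

/-- Quillen–Suslin: every finitely generated projective module over the
polynomial ring k[x_1,…,x_n] over a field k is free. -/
theorem quillen_suslin (k : Type*) [Field k] (n : ℕ)
    (M : Type*) [AddCommGroup M] [Module (MvPolynomial (Fin n) k) M]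
    [Module.Finite (MvPolynomial (Fin n) k) M]
    [Module.Projective (MvPolynomial (Fin n) k) M] :
    Module.Free (MvPolynomial (Fin n) k) M := by
  induction n generalizing M with
  | zero =>
    let _ := ((MvPolynomial.isEmptyAlgEquiv k (Fin 0)).toMulEquiv.isField
      (Field.toIsField k)).toField
    infer_instance
  | succ n ih =>
    refine .of_ringEquiv_polynomial (.mvPolynomial k n) ih fun f hf ↦ ?_
    obtain ⟨ψ, hψ⟩ := MvPolynomial.exists_isUnit_leadingCoeff hf
    exact ⟨ψ.toRingEquiv, hψ⟩
end
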